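/- Let G be a simple graph with maximum degree Δ(G) = 3. Then the Cartesian product G □ K₂ has a proper edge-coloring with 4 colors, i.e., χ'(G □ K₂) = 4. -/

import Mathlib

open SimpleGraph

/-- A (partial) edge-coloring `C` is proper on the edge set `E₀`:
any two distinct edges of `E₀` sharing an endpoint get different colors. -/
def ProperOn {V : Type*} (E₀ : Set (Sym2 V)) (C : Sym2 V → ℕ) : Prop :=
  ∀ e ∈ E₀, ∀ f ∈ E₀, e ≠ f → (∃ v, v ∈ e ∧ v ∈ f) → C e ≠ C f

/-- `G` admits a proper edge-coloring using (at most) `t` colors. -/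
def HasProperEdgeColoring {V : Type*} (G : SimpleGraph V) (t : ℕ) : Prop :=
  ∃ C : Sym2 V → ℕ, (∀ e ∈ G.edgeSet, C e < t) ∧ ProperOn G.edgeSet C

/-- The chromatic index `χ'(G)`. -/
noncomputable def chromIndex {V : Type*} (G : SimpleGraph V) : ℕ :=
  sInf {t | HasProperEdgeColoring G t}

/-- Every proper edge-precoloring of at most `k` edges of `G` extends to a
proper edge-coloring of `G` with `t` colors. -/
def PrecoloringExtendable {V : Type*} (G : SimpleGraph V) (k t : ℕ) : Prop :=
  ∀ E₀ : Set (Sym2 V), E₀ ⊆ G.edgeSet → E₀.ncard ≤ k →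
    ∀ c₀ : Sym2 V → ℕ, (∀ e ∈ E₀, c₀ e < t) → ProperOn E₀ c₀ →
      ∃ C : Sym2 V → ℕ, (∀ e ∈ G.edgeSet, C e < t) ∧ ProperOn G.edgeSet C ∧
        ∀ e ∈ E₀, C e = c₀ e

/-- A square matrix of naturals with constant positive row and column sums has a transversal
of nonzero entries. -/
lemma exists_perm_forall_ne_zero {V : Type*} [Fintype V] [DecidableEq V] (M : V → V → ℕ)
    {k : ℕ} (hk : 0 < k) (hrow : ∀ i, ∑ j, M i j = k) (hcol : ∀ j, ∑ i, M i j = k) :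
    ∃ σ : Equiv.Perm V, ∀ i, M i (σ i) ≠ 0 := by
  obtain ⟨f, hf, hfm⟩ := (Finset.all_card_le_biUnion_card_iff_exists_injective
    (fun i => Finset.univ.filter fun j => M i j ≠ 0)).1 (fun s => by
      refine Nat.le_of_mul_le_mul_right ?_ hk
      set T := s.biUnion fun i => Finset.univ.filter fun j => M i j ≠ 0 with hT
      calc s.card * k = ∑ i ∈ s, ∑ j, M i j := by simp [hrow]
        _ = ∑ i ∈ s, ∑ j ∈ T, M i j := by
          refine Finset.sum_congr rfl fun i hi => (Finset.sum_subset T.subset_univ ?_).symm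
          intro j _ hj
          by_contra h
          exact hj (Finset.mem_biUnion.2 ⟨i, hi, by simpa using h⟩)
        _ = ∑ j ∈ T, ∑ i ∈ s, M i j := Finset.sum_comm
        _ ≤ ∑ j ∈ T, ∑ i, M i j :=
          Finset.sum_le_sum fun j _ => Finset.sum_le_sum_of_subset s.subset_univ
        _ = T.card * k := by simp [hcol])
  exact ⟨Equiv.ofBijective f (Finite.injective_iff_bijective.1 hf),
    fun i => by simpa using hfm i⟩

/-- The support of a square matrix of naturals with all row and column sums equal to `k` is
covered by `k` permutations. -/
lemma exists_perms_cover {V : Type*} [Fintype V] [DecidableEq V] (k : ℕ) (M : V → V → ℕ)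
    (hrow : ∀ i, ∑ j, M i j = k) (hcol : ∀ j, ∑ i, M i j = k) :
    ∃ σ : Fin k → Equiv.Perm V, ∀ i j, M i j ≠ 0 → ∃ t, σ t i = j := by
  induction k generalizing M with
  | zero =>
    refine ⟨Fin.elim0, fun i j h => absurd ?_ h⟩
    exact Finset.sum_eq_zero_iff.1 (hrow i) j (Finset.mem_univ j)
  | succ k ih =>
    obtain ⟨τ, hτ⟩ := exists_perm_forall_ne_zero M k.succ_pos hrow hcol
    have hsub : ∀ i j, (M i j - if τ i = j then 1 else 0) + (if τ i = j then 1 else 0) = M i j := by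
      intro i j
      split_ifs with h
      · have := hτ i
        rw [h] at this
        omega
      · simp
    obtain ⟨σ, hσ⟩ := ih (fun i j => M i j - if τ i = j then 1 else 0)
      (fun i => by
        have h := (Finset.sum_congr rfl fun j _ => hsub i j).trans (hrow i)
        rw [Finset.sum_add_distrib] at h
        simpa using h)
      (fun j => by
        have h := (Finset.sum_congr rfl fun i _ => hsub i j).trans (hcol j)
        rw [Finset.sum_add_distrib] at h
        simpa [← Equiv.eq_symm_apply] using h)
    refine ⟨Fin.cons τ σ, fun i j hij => ?_⟩
    by_cases h : τ i = j
    · exact ⟨0, h⟩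
    · obtain ⟨t, ht⟩ := hσ i j (by simpa [h] using hij)
      exact ⟨t.succ, by simpa using ht⟩

/-- A maximum cut leaves at each vertex at most half of the neighbors on its own side. -/
lemma exists_cut {V : Type*} [Fintype V] (G : SimpleGraph V) [DecidableRel G.Adj] :
    ∃ s : V → Bool, ∀ x,
      2 * ((G.neighborFinset x).filter fun v => s v = s x).card ≤ G.degree x := by
  classical
  let mono (s : V → Bool) : Finset (V × V) :=
    Finset.univ.filter fun p => G.Adj p.1 p.2 ∧ s p.1 = s p.2
  obtain ⟨s, hs⟩ := Finite.exists_min fun s => (mono s).card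
  refine ⟨s, fun x => ?_⟩
  let same := (G.neighborFinset x).filter fun v => s v = s x
  let opp := (G.neighborFinset x).filter fun v => ¬ s v = s x
  have hdeg : same.card + opp.card = G.degree x :=
    Finset.card_filter_add_card_filter_not _
  let rest : Finset (V × V) :=
    (mono s).filter fun p => p.1 ≠ x ∧ p.2 ≠ x
  have inj₁ : Function.Injective fun v : V => (x, v) := fun _ _ h => (Prod.ext_iff.1 h).2
  have inj₂ : Function.Injective fun v : V => (v, x) := fun _ _ h => (Prod.ext_iff.1 h).1
  have hcard : ∀ A ⊆ G.neighborFinset x,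
      (rest ∪ A.image (fun v => (x, v)) ∪ A.image (fun v => (v, x))).card
        = rest.card + 2 * A.card := by
    intro A hA
    have hA' : x ∉ A := fun h => by simpa using hA h
    rw [Finset.card_union_of_disjoint, Finset.card_union_of_disjoint,
      Finset.card_image_of_injective _ inj₁, Finset.card_image_of_injective _ inj₂]
    · ring
    · rw [Finset.disjoint_left]
      grind
    · rw [Finset.disjoint_left]
      grind
  have h₁ : mono s = rest ∪ same.image (fun v => (x, v)) ∪ same.image (fun v => (v, x)) := by
    ext ⟨a, b⟩
    have := G.adj_comm a b
    simp only [mono, rest, same, Finset.mem_union, Finset.mem_filter, Finset.mem_image,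
      Finset.mem_univ, true_and, mem_neighborFinset, Prod.mk.injEq]
    grind
  have h₂ : mono (Function.update s x (!s x))
      = rest ∪ opp.image (fun v => (x, v)) ∪ opp.image (fun v => (v, x)) := by
    clear h₁ hcard hs
    ext ⟨a, b⟩
    simp only [mono, rest, opp, Finset.mem_union, Finset.mem_filter, Finset.mem_image,
      Finset.mem_univ, true_and, mem_neighborFinset, Prod.mk.injEq, Function.update_apply]
    by_cases ha : a = x <;> by_cases hb : b = x
    · simp [ha, hb]
    · cases hx : s x <;> simp [ha, hb, Ne.symm hb, hx]
    · cases hx : s x <;> simp [ha, hb, Ne.symm ha, G.adj_comm a x, hx]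
    · simp [ha, hb, Ne.symm ha, Ne.symm hb]
  have h := hs (Function.update s x (!s x))
  simp only [h₁, h₂] at h
  rw [hcard same (Finset.filter_subset _ _), hcard opp (Finset.filter_subset _ _)] at h
  change 2 * same.card ≤ _
  omega

/-- The edges of a graph of maximum degree at most `k` crossing a fixed cut can be properly
colored with `k` colors. -/
lemma exists_crossing_coloring {V : Type*} [Fintype V] (G : SimpleGraph V) [DecidableRel G.Adj]
    {k : ℕ} (hdeg : ∀ v, G.degree v ≤ k) (s : V → Bool) :
    ∃ c : V → V → ℕ, (∀ u v, c u v = c v u) ∧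
      (∀ u v, G.Adj u v → s u ≠ s v → c u v < k) ∧
      ∀ u v w, G.Adj u v → G.Adj u w → s u ≠ s v → s u ≠ s w → c u v = c u w → v = w := by
  classical
  let M (u v : V) : ℕ :=
    (if G.Adj u v then 1 else 0) + if u = v then k - G.degree u else 0
  have hsymm : ∀ u v, M u v = M v u := by
    intro u v
    by_cases h : u = v
    · rw [h]
    · simp [M, h, Ne.symm h, G.adj_comm]
  have hrow : ∀ u, ∑ v, M u v = k := by
    intro u
    have := hdeg u
    simp only [M, Finset.sum_add_distrib, Finset.sum_boole, Finset.sum_ite_eq, Finset.mem_univ,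
      if_true, ← neighborFinset_eq_filter, card_neighborFinset_eq_degree, Nat.cast_id]
    omega
  obtain ⟨σ, hσ⟩ := exists_perms_cover k M hrow fun v => by simpa only [hsymm _ v] using hrow v
  have hcov : ∀ u v, ∃ t : ℕ, G.Adj u v → ∃ h : t < k, σ ⟨t, h⟩ u = v := by
    intro u v
    by_cases h : G.Adj u v
    · obtain ⟨t, ht⟩ := hσ u v (by simp [M, h])
      exact ⟨t, fun _ => ⟨t.2, ht⟩⟩
    · exact ⟨0, fun h' => absurd h' h⟩
  choose t ht using hcov
  have hout : ∀ u v w, G.Adj u v → G.Adj u w → t u v = t u w → v = w := by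
    intro u v w huv huw h
    obtain ⟨_, h₁⟩ := ht u v huv
    obtain ⟨_, h₂⟩ := ht u w huw
    rw [← h₁, ← h₂]
    simp only [h]
  have hin : ∀ u v w, G.Adj v u → G.Adj w u → t v u = t w u → v = w := by
    intro u v w hvu hwu h
    obtain ⟨_, h₁⟩ := ht v u hvu
    obtain ⟨_, h₂⟩ := ht w u hwu
    simp only [h] at h₁
    exact (σ _).injective (h₁.trans h₂.symm)
  refine ⟨fun u v => if s u = s v then 0 else if s u then t u v else t v u, ?_, ?_, ?_⟩
  · intro u v
    cases hu : s u <;> cases hv : s v <;> simp [hu, hv]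
  · intro u v huv hs
    have h₁ := (ht u v huv).1
    have h₂ := (ht v u huv.symm).1
    simp only [hs, if_false]
    split_ifs <;> assumption
  · intro u v w huv huw hv hw h
    simp only [hv, hw, if_false] at h
    split_ifs at h
    · exact hout u v w huv huw h
    · exact hin u v w huv.symm huw.symm h

/-- A graph of maximum degree at most three has a proper edge-coloring with four colors, here
given as a symmetric function on pairs of vertices. -/
lemma exists_four_edge_coloring {V : Type*} [Fintype V] (G : SimpleGraph V) [DecidableRel G.Adj]
    (hdeg : ∀ v, G.degree v ≤ 3) :
    ∃ c : V → V → ℕ, (∀ u v, c u v = c v u) ∧ (∀ u v, G.Adj u v → c u v < 4) ∧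
      ∀ u v w, G.Adj u v → G.Adj u w → c u v = c u w → v = w := by
  obtain ⟨s, hs⟩ := exists_cut G
  obtain ⟨c, hsymm, hlt, hc⟩ := exists_crossing_coloring G hdeg s
  have huniq : ∀ u v w, G.Adj u v → G.Adj u w → s u = s v → s u = s w → v = w := by
    intro u v w huv huw hv hw
    have hcard : ((G.neighborFinset u).filter fun v => s v = s u).card ≤ 1 := by
      have := hs u
      have := hdeg u
      omega
    exact Finset.card_le_one.1 hcard v (by simp [huv, hv]) w (by simp [huw, hw])
  refine ⟨fun u v => if s u = s v then 3 else c u v, ?_, ?_, ?_⟩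
  · intro u v
    simp only [hsymm u v, eq_comm]
  · intro u v huv
    have := hlt u v huv
    simp only
    split_ifs with h
    · norm_num
    · exact (this h).trans (by norm_num)
  · intro u v w huv huw h
    have := hlt u v huv
    have := hlt u w huw
    have := huniq u v w huv huw
    have := hc u v w huv huw
    grind

/-- A symmetric function that is injective on the neighbors of each vertex gives a proper
edge-coloring. -/
lemma HasProperEdgeColoring.of_symm {W : Type*} (H : SimpleGraph W) {t : ℕ} (c : W → W → ℕ)
    (hsymm : ∀ u v, c u v = c v u) (hlt : ∀ u v, H.Adj u v → c u v < t)
    (hc : ∀ u v w, H.Adj u v → H.Adj u w → c u v = c u w → v = w) :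
    HasProperEdgeColoring H t := by
  refine ⟨Sym2.lift ⟨c, hsymm⟩, fun e => Sym2.ind (fun u v h => hlt u v h) e, ?_⟩
  rintro e he f hf hne ⟨v, hve, hvf⟩ heq
  obtain ⟨a, rfl⟩ := hve
  obtain ⟨b, rfl⟩ := hvf
  exact hne (by rw [hc v a b he hf heq])

/-- A proper edge-coloring needs at least as many colors as the degree of any vertex. -/
lemma HasProperEdgeColoring.degree_le {W : Type*} {H : SimpleGraph W} {t : ℕ}
    (h : HasProperEdgeColoring H t) (v : W) [Fintype (H.neighborSet v)] : H.degree v ≤ t := by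
  obtain ⟨C, hlt, hC⟩ := h
  rw [← card_neighborFinset_eq_degree, ← Finset.card_range t]
  refine Finset.card_le_card_of_injOn (fun w => C s(v, w)) (fun w hw => ?_) ?_
  · simpa using hlt s(v, w) (by simpa using hw)
  · intro a ha b hb hab
    by_contra hne
    exact hC s(v, a) (by simpa using ha) s(v, b) (by simpa using hb)
      (fun h => hne (Sym2.congr_right.1 h)) ⟨v, by simp, by simp⟩ hab

/-- If `Δ(G) = 3`, then `G □ K₂` has a proper 4-edge-coloring, i.e. `χ'(G □ K₂) = 4`. -/
theorem stmt_14 {V : Type*} [Fintype V] (G : SimpleGraph V) [DecidableRel G.Adj]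
    (hdeg : G.maxDegree = 3) :
    HasProperEdgeColoring (G □ (⊤ : SimpleGraph (Fin 2))) 4 ∧
      chromIndex (G □ (⊤ : SimpleGraph (Fin 2))) = 4 := by
  classical
  have hle : ∀ v, G.degree v ≤ 3 := fun v => hdeg ▸ G.degree_le_maxDegree v
  have hcol : HasProperEdgeColoring (G □ (⊤ : SimpleGraph (Fin 2))) 4 := by
    obtain ⟨c, hsymm, hlt, hc⟩ := exists_four_edge_coloring G hle
    have hmiss : ∀ v, ∃ m < 4, ∀ w, G.Adj v w → c v w ≠ m := by
      intro v
      obtain ⟨m, hm, hm'⟩ := Finset.exists_mem_notMem_of_card_lt_card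
        (s := (G.neighborFinset v).image (c v)) (t := Finset.range 4)
        (by
          rw [Finset.card_range]
          exact (Finset.card_image_le.trans (hle v)).trans_lt (by norm_num))
      refine ⟨m, Finset.mem_range.1 hm, fun w hw h => hm' ?_⟩
      exact Finset.mem_image.2 ⟨w, by simpa using hw, h⟩
    choose m hm hmc using hmiss
    refine .of_symm _ (fun p q => if p.1 = q.1 then m p.1 else c p.1 q.1) ?_ ?_ ?_
    · rintro ⟨u, i⟩ ⟨v, j⟩
      by_cases h : u = v
      · simp [h]
      · simp [h, Ne.symm h, hsymm u v]
    · rintro ⟨u, i⟩ ⟨v, j⟩ h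
      rcases boxProd_adj.1 h with ⟨h, -⟩ | ⟨-, h⟩
      · simpa [h.ne] using hlt u v h
      · simpa [show u = v from h] using hm v
    · rintro ⟨u, i⟩ ⟨v, j⟩ ⟨w, l⟩ hv hw h
      simp only [boxProd_adj, top_adj] at hv hw
      have := hmc u v
      have := hmc u w
      have := hc u v w
      have := G.irrefl (v := u)
      simp only [Prod.mk.injEq]
      grind
  refine ⟨hcol, le_antisymm (Nat.sInf_le hcol) ?_⟩
  have : Nonempty V := by
    by_contra h
    rw [not_nonempty_iff] at h
    simp at hdeg
  obtain ⟨v, hv⟩ := G.exists_maximal_degree_vertex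
  refine le_csInf ⟨4, hcol⟩ fun t ht => ?_
  have hd := HasProperEdgeColoring.degree_le ht (v, 0)
  rw [degree_boxProd, ← hv, hdeg] at hd
  simpa using hd
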